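/- (Efficient encodability of EPS) Let n ≥ 2, N = 2^n, let A ⊆ {0, ..., N−1} be domination-upward-closed, let D = { i ∈ {0, ..., N−1} : i ≡ 3 (mod 4) }, let D_f = Ā ∩ D, and let C = A ∪ D_f. Then the submatrix G_CC of G_N = F^{⊗n} satisfies G_CC · G_CC = I over GF(2), i.e., G_CC is its own inverse. -/

import Mathlib

open Matrix

/-- The polar kernel `F = [[1,0],[1,1]]` over `GF(2)`. -/
def polarF : Matrix (Fin 2) (Fin 2) (ZMod 2) := !![1, 0; 1, 1]

/-- The `n`-fold Kronecker power `G_N = F^{⊗ n}` over `GF(2)`,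
indexed by `Fin (2 ^ n)` via the standard mixed-radix (binary) identification. -/
def polarG : (n : ℕ) → Matrix (Fin (2 ^ n)) (Fin (2 ^ n)) (ZMod 2)
  | 0 => 1
  | n + 1 =>
      Matrix.reindex
        (finProdFinEquiv.trans (finCongr (by rw [pow_succ, Nat.mul_comm])))
        (finProdFinEquiv.trans (finCongr (by rw [pow_succ, Nat.mul_comm])))
        (Matrix.kronecker polarF (polarG n))

/-- Binary domination `i ⪰ j` : every bit equal to 1 in `j` is also 1 in `i`. -/
def Dominates (i j : ℕ) : Prop := ∀ t : ℕ, j.testBit t = true → i.testBit t = true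

/-- `A` is domination-upward-closed. -/
def UpClosed {n : ℕ} (A : Finset (Fin (2 ^ n))) : Prop :=
  ∀ i ∈ A, ∀ j : Fin (2 ^ n), Dominates (j : ℕ) (i : ℕ) → j ∈ A

/-- The square submatrix `G_CC` of `G_N`, rows and columns indexed by the
elements of `C` listed in increasing order. -/
def subCC {n : ℕ} (C : Finset (Fin (2 ^ n))) :
    Matrix (Fin C.card) (Fin C.card) (ZMod 2) :=
  (polarG n).submatrix (⇑(C.orderEmbOfFin rfl)) (⇑(C.orderEmbOfFin rfl))

theorem polarF_mul_self : polarF * polarF = 1 := by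
  decide

theorem polarG_mul_self (n : ℕ) : polarG n * polarG n = 1 := by
  induction n with
  | zero => exact mul_one 1
  | succ n ih =>
    simp only [polarG, reindex_apply, submatrix_mul_equiv]
    rw [kronecker, ← mul_kronecker_mul, ih, polarF_mul_self, one_kronecker_one,
      submatrix_one_equiv]

theorem dominates_two_pow_mul_add {n a b c d : ℕ} (hb : b < 2 ^ n) (hd : d < 2 ^ n)
    (hac : Dominates a c) (hbd : Dominates b d) :
    Dominates (2 ^ n * a + b) (2 ^ n * c + d) := by
  intro t
  rw [Nat.testBit_two_pow_mul_add _ hb, Nat.testBit_two_pow_mul_add _ hd]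
  split
  · exact hbd t
  · exact hac (t - n)

theorem dominates_of_polarF_ne_zero {i j : Fin 2} (h : polarF i j ≠ 0) :
    Dominates (i : ℕ) (j : ℕ) := by
  fin_cases i <;> fin_cases j <;> simp_all [polarF, Dominates]

theorem dominates_of_polarG_ne_zero {n : ℕ} {i j : Fin (2 ^ n)} (h : polarG n i j ≠ 0) :
    Dominates (i : ℕ) (j : ℕ) := by
  induction n with
  | zero =>
    obtain rfl : i = j := Subsingleton.elim (α := Fin 1) i j
    exact fun _ ht => ht
  | succ n ih =>
    have e : 2 * 2 ^ n = 2 ^ (n + 1) := by rw [pow_succ, Nat.mul_comm]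
    obtain ⟨⟨a, b⟩, rfl⟩ := (finProdFinEquiv.trans (finCongr e)).surjective i
    obtain ⟨⟨c, d⟩, rfl⟩ := (finProdFinEquiv.trans (finCongr e)).surjective j
    rw [polarG, reindex_apply, submatrix_apply, Equiv.symm_apply_apply,
      Equiv.symm_apply_apply] at h
    replace h : polarF a c * polarG n b d ≠ 0 := h
    have hdom := dominates_two_pow_mul_add b.isLt d.isLt
      (dominates_of_polarF_ne_zero (left_ne_zero_of_mul h)) (ih (right_ne_zero_of_mul h))
    simpa [add_comm] using hdom

/-- The submatrix of `G_N` on a domination-upward-closed index set is an involution. -/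
theorem subCC_mul_self {n : ℕ} {C : Finset (Fin (2 ^ n))} (hC : UpClosed C) :
    subCC C * subCC C = 1 := by
  have hsum (i j : Fin (2 ^ n)) (hj : j ∈ C) :
      ∑ k ∈ C, polarG n i k * polarG n k j = (1 : Matrix _ _ (ZMod 2)) i j := by
    rw [← polarG_mul_self n, mul_apply]
    refine Finset.sum_subset C.subset_univ fun k _ hk => ?_
    by_contra h
    exact hk (hC j hj k (dominates_of_polarG_ne_zero (right_ne_zero_of_mul h)))
  ext i j
  rw [← submatrix_one (C.orderEmbOfFin rfl) (C.orderEmbOfFin rfl).injective, submatrix_apply,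
    ← hsum _ _ (C.orderEmbOfFin_mem rfl j), mul_apply]
  have hreindex (f : Fin (2 ^ n) → ZMod 2) :
      ∑ k ∈ C, f k = ∑ k, f (C.orderEmbOfFin rfl k) := by
    conv_lhs => rw [← C.map_orderEmbOfFin_univ rfl, Finset.sum_map]
    rfl
  rw [hreindex]
  rfl

theorem Dominates.mod_four_eq_three {i j : ℕ} (h : Dominates i j) (hj : j % 4 = 3) :
    i % 4 = 3 := by
  have h0 := h 0
  have h1 := h 1
  simp only [Nat.testBit_eq_decide_div_mod_eq, decide_eq_true_eq] at h0 h1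
  lia

theorem UpClosed.union_mod_four {n : ℕ} {A : Finset (Fin (2 ^ n))} (hA : UpClosed A) :
    UpClosed (A ∪ (Aᶜ ∩ Finset.univ.filter (fun i : Fin (2 ^ n) => (i : ℕ) % 4 = 3))) := by
  intro i hi j hij
  simp only [Finset.mem_union, Finset.mem_inter, Finset.mem_compl, Finset.mem_filter,
    Finset.mem_univ, true_and] at hi ⊢
  by_cases hj : j ∈ A
  · exact Or.inl hj
  · obtain hi | ⟨-, hi⟩ := hi
    · exact absurd (hA i hi j hij) hj
    · exact Or.inr ⟨hj, hij.mod_four_eq_three hi⟩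

/-- efficient encodability of EPS: with `A` domination-upward-closed,
`D = {i : i ≡ 3 (mod 4)}`, `D_f = Ā ∩ D` and `C = A ∪ D_f`, the submatrix `G_CC`
is its own inverse over `GF(2)`. -/
theorem EPS_subCC_involution (n : ℕ) (hn : 2 ≤ n)
    (A : Finset (Fin (2 ^ n))) (hA : UpClosed A) :
    subCC (A ∪ (Aᶜ ∩ Finset.univ.filter (fun i : Fin (2 ^ n) => (i : ℕ) % 4 = 3))) *
      subCC (A ∪ (Aᶜ ∩ Finset.univ.filter (fun i : Fin (2 ^ n) => (i : ℕ) % 4 = 3))) = 1 :=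
  subCC_mul_self hA.union_mod_four
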